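/- Surjectivity of I + A for the Tresca relation, and its maximality (pointwise form of Lemma 5.8): Let V be a real Hilbert space, τ > 0, and A_τ := {(σ, e) ∈ V × V : ‖σ‖ ≤ τ and (e = 0 or τ·e = ‖e‖·σ)}. Then for every w ∈ V there exist σ, e ∈ V with (σ, e) ∈ A_τ and σ + e = w. Moreover, A_τ is maximal monotone: every monotone relation B ⊆ V × V with A_τ ⊆ B satisfies B = A_τ. -/

import Mathlib

open scoped RealInnerProductSpace

/-- A binary relation `A ⊆ V × V` is monotone. -/
def IsMonotoneRel {V : Type*} [NormedAddCommGroup V] [InnerProductSpace ℝ V]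
    (A : Set (V × V)) : Prop :=
  ∀ p ∈ A, ∀ q ∈ A, (0 : ℝ) ≤ ⟪p.1 - q.1, p.2 - q.2⟫

/-- The pointwise Tresca friction relation with threshold `τ`. -/
def trescaRel {V : Type*} [NormedAddCommGroup V] [InnerProductSpace ℝ V] (τ : ℝ) :
    Set (V × V) :=
  {p : V × V | ‖p.1‖ ≤ τ ∧ (p.2 = 0 ∨ τ • p.2 = ‖p.2‖ • p.1)}

/-- `I + A_τ` is surjective, and the Tresca relation is maximal monotone. -/
theorem trescaRel_surjective_and_maximal {V : Type*} [NormedAddCommGroup V]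
    [InnerProductSpace ℝ V] [CompleteSpace V] (τ : ℝ) (hτ : 0 < τ) :
    (∀ w : V, ∃ σ e : V, (σ, e) ∈ trescaRel (V := V) τ ∧ σ + e = w) ∧
    (∀ B : Set (V × V), IsMonotoneRel B → trescaRel (V := V) τ ⊆ B →
      B = trescaRel (V := V) τ) := by
  have surj : ∀ w : V, ∃ σ e : V, (σ, e) ∈ trescaRel (V := V) τ ∧ σ + e = w := by
    intro w
    by_cases hw : ‖w‖ ≤ τ
    · exact ⟨w, 0, ⟨hw, Or.inl rfl⟩, add_zero w⟩
    · have hw' : τ < ‖w‖ := not_le.mp hw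
      have hpos : 0 < ‖w‖ := hτ.trans hw'
      have h1 : τ / ‖w‖ ≤ 1 := (div_le_one hpos).2 hw'.le
      refine ⟨(τ / ‖w‖) • w, (1 - τ / ‖w‖) • w, ⟨?_, Or.inr ?_⟩, ?_⟩
      · show ‖(τ / ‖w‖) • w‖ ≤ τ
        rw [norm_smul, Real.norm_of_nonneg (by positivity), div_mul_cancel₀ _ hpos.ne']
      · show τ • ((1 - τ / ‖w‖) • w) = ‖(1 - τ / ‖w‖) • w‖ • ((τ / ‖w‖) • w)
        rw [norm_smul, Real.norm_of_nonneg (by linarith), smul_smul, smul_smul]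
        congr 1
        field_simp
      · rw [← add_smul]
        simp
  refine ⟨surj, fun B hB hAB => Set.Subset.antisymm ?_ hAB⟩
  rintro ⟨s, e⟩ hp
  obtain ⟨σ, f, hA, hw⟩ := surj (s + e)
  have h : (0 : ℝ) ≤ ⟪s - σ, e - f⟫ := hB _ hp _ (hAB hA)
  have hef : e - f = -(s - σ) := by
    have h2 : f = s + e - σ := by rw [← hw]; abel
    rw [h2]; abel
  rw [hef, inner_neg_right, real_inner_self_eq_norm_sq] at h
  have h0 : ‖s - σ‖ = 0 := by
    have : ‖s - σ‖ ^ 2 = 0 := le_antisymm (by linarith) (sq_nonneg _)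
    exact pow_eq_zero_iff (two_ne_zero) |>.1 this
  have hs : s - σ = 0 := norm_eq_zero.1 h0
  rw [hs, neg_zero] at hef
  rw [sub_eq_zero.1 hs, sub_eq_zero.1 hef]
  exact hA
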